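/- arXiv:1711.05092 — 2 statements merged into one kernel-verified Lean document; each statement's English description precedes it below -/
import Mathlib

section
/- For any voter i and any committees W, W' ⊆ C of size k, if W_i* ⊆ W and W_i* ⊄ W', then U_i(W) > U_i(W'). -/
open Finset

/-- The 0-indexed rank of candidate `c` within committee `W` with respect to the utility `u`:
the number of members of `W` strictly preferred to `c`.  Thus the most preferred member of `W`
has rank `0`. -/
noncomputable def owaRank {C : Type*} (u : C → ℝ) (W : Finset C) (c : C) : ℕ :=
  (W.filter fun c' => u c < u c').card

/-- The OWA set-extension utility determined by the weights `lam` (where `lam 0` is the weight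
`λ₁` put on the most preferred committee member, `lam 1` is `λ₂`, and so on) and the
utility function `u`. -/
noncomputable def owaUtil {C : Type*} (lam : ℕ → ℝ) (u : C → ℝ) (W : Finset C) : ℝ :=
  ∑ c ∈ W, lam (owaRank u W c) * u c

/-- The approval score of candidate `c` under the ballot profile `A`. -/
def score {N C : Type*} [Fintype N] [DecidableEq C] (A : N → Finset C) (c : C) : ℕ :=
  (Finset.univ.filter fun i => c ∈ A i).card

/-- Candidate `c` is ranked above candidate `c'` by the best-`k` scoring rule with scoring
function `g`, with ties broken by the priority order: `c < c'` means `c` has higher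
priority (`c ▷ c'`). -/
def beats {N C : Type*} [Fintype N] [DecidableEq C] [LT C]
    (g : C → ℕ → ℝ) (A : N → Finset C) (c c' : C) : Prop :=
  g c' (score A c') < g c (score A c) ∨
    (g c (score A c) = g c' (score A c') ∧ c < c')

open Classical in
/-- The winning committee: the `k` top-ranked candidates. -/
noncomputable def winners {N C : Type*} [Fintype N] [Fintype C] [DecidableEq C] [LT C]
    (g : C → ℕ → ℝ) (k : ℕ) (A : N → Finset C) : Finset C :=
  Finset.univ.filter fun c => (Finset.univ.filter fun c' => beats g A c' c).card < k

/-- `B` is a best-response ballot of voter `i` against the other voters' ballots in `A`. -/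
def BestResponse {N C : Type*} [Fintype N] [DecidableEq N] [Fintype C] [DecidableEq C] [LT C]
    (g : C → ℕ → ℝ) (k : ℕ) (lam : ℕ → ℝ) (u : C → ℝ)
    (A : N → Finset C) (i : N) (B : Finset C) : Prop :=
  ∀ B' : Finset C,
    owaUtil lam u (winners g k (Function.update A i B')) ≤
      owaUtil lam u (winners g k (Function.update A i B))

/-- `B` is a minimal best-response ballot of voter `i`. -/
def MinimalBestResponse {N C : Type*} [Fintype N] [DecidableEq N] [Fintype C] [DecidableEq C]
    [LT C] (g : C → ℕ → ℝ) (k : ℕ) (lam : ℕ → ℝ) (u : C → ℝ)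
    (A : N → Finset C) (i : N) (B : Finset C) : Prop :=
  BestResponse g k lam u A i B ∧
    ∀ B' : Finset C, BestResponse g k lam u A i B' → B.card ≤ B'.card

/-- A ballot profile is a lazy pure Nash equilibrium if every voter's ballot is a minimal
best response to the other voters' ballots. -/
def LazyPNE {N C : Type*} [Fintype N] [DecidableEq N] [Fintype C] [DecidableEq C] [LT C]
    (g : C → ℕ → ℝ) (k : ℕ) (lam : N → ℕ → ℝ) (u : N → C → ℝ) (A : N → Finset C) : Prop :=
  ∀ i, MinimalBestResponse g k (lam i) (u i) A i (A i)

/-- A ballot is sincere if every approved candidate is preferred to every unapproved one. -/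
def Sincere {C : Type*} (u : C → ℝ) (B : Finset C) : Prop :=
  ∀ c ∈ B, ∀ c' ∉ B, u c' < u c

theorem owaRank_lt_card {C : Type*} (u : C → ℝ) {W : Finset C} {c : C} (hc : c ∈ W) :
    owaRank u W c < W.card :=
  card_lt_card <| filter_ssubset.2 ⟨c, hc, lt_irrefl _⟩

theorem owaRank_lt_owaRank {C : Type*} (u : C → ℝ) {W : Finset C} {c d : C} (hd : d ∈ W)
    (h : u c < u d) : owaRank u W d < owaRank u W c := by
  refine card_lt_card ((ssubset_iff_of_subset ?_).2 ⟨d, by simp [hd, h], by simp⟩)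
  exact monotone_filter_right W fun _ _ hx => h.trans hx

theorem owaRank_injOn {C : Type*} {u : C → ℝ} (hu : Function.Injective u) (W : Finset C) :
    Set.InjOn (owaRank u W) W := by
  intro c hc d hd h
  apply hu
  rcases lt_trichotomy (u c) (u d) with hlt | heq | hlt
  · exact absurd h (owaRank_lt_owaRank u hd hlt).ne'
  · exact heq
  · exact absurd h (owaRank_lt_owaRank u hc hlt).ne

theorem image_owaRank {C : Type*} {u : C → ℝ} (hu : Function.Injective u) (W : Finset C) :
    W.image (owaRank u W) = range W.card := by
  refine eq_of_subset_of_card_le ?_ ?_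
  · intro n hn
    obtain ⟨c, hc, rfl⟩ := mem_image.1 hn
    exact mem_range.2 (owaRank_lt_card u hc)
  · rw [card_image_of_injOn (owaRank_injOn hu W), card_range]

/-- A nonempty committee can be listed in order of decreasing utility, and its OWA utility is the
weighted sum of the utilities along this list. -/
theorem exists_owaUtil_eq_sum_range {C : Type*} {u : C → ℝ} (hu : Function.Injective u)
    (lam : ℕ → ℝ) {W : Finset C} (hW : W.Nonempty) :
    ∃ f : ℕ → C, (∀ n < W.card, f n ∈ W ∧ owaRank u W (f n) = n) ∧
      owaUtil lam u W = ∑ n ∈ range W.card, lam n * u (f n) := by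
  obtain ⟨c₀, -⟩ := hW
  have key : ∀ n, ∃ c, n < W.card → c ∈ W ∧ owaRank u W c = n := by
    intro n
    by_cases hn : n < W.card
    · rw [← mem_range, ← image_owaRank hu W, mem_image] at hn
      obtain ⟨c, hc⟩ := hn
      exact ⟨c, fun _ => hc⟩
    · exact ⟨c₀, fun h => absurd h hn⟩
  choose f hf using key
  refine ⟨f, hf, ?_⟩
  have hfc : ∀ c ∈ W, f (owaRank u W c) = c := fun c hc =>
    have h := hf _ (owaRank_lt_card u hc)
    owaRank_injOn hu W h.1 hc h.2
  refine sum_nbij' (owaRank u W) f ?_ ?_ hfc ?_ ?_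
  · exact fun c hc => mem_range.2 (owaRank_lt_card u hc)
  · exact fun n hn => (hf n (mem_range.1 hn)).1
  · exact fun n hn => (hf n (mem_range.1 hn)).2
  · intro c hc
    rw [hfc c hc]

theorem mem_of_le_of_mem_top {C : Type*} {u : C → ℝ} {T : Finset C}
    (hT : ∀ c ∈ T, ∀ c' ∉ T, u c' < u c) {c d : C} (hc : c ∈ T) (h : u c ≤ u d) : d ∈ T := by
  by_contra hd
  exact (hT c hc d hd).not_ge h

theorem mem_top_of_owaRank_lt {C : Type*} {u : C → ℝ} {T W : Finset C}
    (hT : ∀ c ∈ T, ∀ c' ∉ T, u c' < u c) (hTW : T ⊆ W) {c : C}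
    (h : owaRank u W c < T.card) : c ∈ T := by
  by_contra hc
  refine h.not_ge (card_le_card fun x hx => ?_)
  exact mem_filter.2 ⟨hTW hx, hT x hx c hc⟩

theorem le_of_owaRank_eq {C : Type*} {u : C → ℝ} {T W W' : Finset C}
    (hT : ∀ c ∈ T, ∀ c' ∉ T, u c' < u c) (hTW : T ⊆ W) {c d : C} (hc : c ∈ T)
    (h : owaRank u W' d = owaRank u W c) : u d ≤ u c := by
  by_contra! hlt
  have hdW : d ∈ W := hTW (mem_of_le_of_mem_top hT hc hlt.le)
  refine (h ▸ owaRank_lt_owaRank u hdW hlt).not_ge (card_le_card fun x hx => ?_)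
  obtain ⟨-, hx⟩ := mem_filter.1 hx
  exact mem_filter.2 ⟨hTW (mem_of_le_of_mem_top hT hc (hlt.trans hx).le), hx⟩

theorem subset_of_card_le_owaRank_add_one {C : Type*} {u : C → ℝ} {T W' : Finset C}
    (hT : ∀ c ∈ T, ∀ c' ∉ T, u c' < u c) {d : C} (hdT : d ∈ T) (hd : d ∈ W')
    (h : T.card ≤ owaRank u W' d + 1) : T ⊆ W' := by
  have hsub : (W'.filter fun x => u d < u x).cons d (by simp) ⊆ T := by
    intro x hx
    rcases mem_cons.1 hx with rfl | hx
    · exact hdT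
    · exact mem_of_le_of_mem_top hT hdT (mem_filter.1 hx).2.le
  rw [← eq_of_subset_of_card_le hsub (by rwa [card_cons])]
  intro x hx
  rcases mem_cons.1 hx with rfl | hx
  · exact hd
  · exact (mem_filter.1 hx).1

/-- a committee containing voter `i`'s ideal set `W_i*` is strictly preferred to
any committee of size `k` not containing it. -/
theorem statement_9 {C : Type*} [Fintype C] [DecidableEq C]
    (k : ℕ) (hk1 : 1 ≤ k) (hk2 : k ≤ Fintype.card C)
    (u : C → ℝ) (hu : Function.Injective u)
    (lam : ℕ → ℝ) (hlam : ∀ n, 0 ≤ lam n)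
    (jstar : ℕ) (hj1 : 1 ≤ jstar) (hjk : jstar ≤ k)
    (hz : ∀ n, jstar ≤ n → lam n = 0) (hpos : 0 < lam (jstar - 1))
    (Wst : Finset C) (hWstcard : Wst.card = jstar)
    (hWsttop : ∀ c ∈ Wst, ∀ c' ∉ Wst, u c' < u c)
    (W W' : Finset C) (hW : W.card = k) (hW' : W'.card = k)
    (h1 : Wst ⊆ W) (h2 : ¬ Wst ⊆ W') :
    owaUtil lam u W' < owaUtil lam u W := by
  obtain ⟨f, hf, hfsum⟩ :=
    exists_owaUtil_eq_sum_range hu lam (card_pos.1 (by omega : 0 < W.card))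
  obtain ⟨g, hg, hgsum⟩ :=
    exists_owaUtil_eq_sum_range hu lam (card_pos.1 (by omega : 0 < W'.card))
  rw [hW] at hf hfsum
  rw [hW'] at hg hgsum
  have hfT : ∀ n < jstar, f n ∈ Wst := fun n hn =>
    mem_top_of_owaRank_lt hWsttop h1 (by rw [(hf n (by omega)).2]; omega)
  have hle : ∀ n < jstar, u (g n) ≤ u (f n) := fun n hn =>
    le_of_owaRank_eq hWsttop h1 (hfT n hn)
      ((hg n (by omega)).2.trans (hf n (by omega)).2.symm)
  have hlast : jstar - 1 < jstar := by omega
  rw [hfsum, hgsum]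
  refine sum_lt_sum (fun n _ => ?_) ⟨jstar - 1, mem_range.2 (by omega), ?_⟩
  · rcases lt_or_ge n jstar with hn | hn
    · exact mul_le_mul_of_nonneg_left (hle n hn) (hlam n)
    · simp [hz n hn]
  · refine mul_lt_mul_of_pos_left ((hle _ hlast).lt_of_ne fun heq => h2 ?_) hpos
    obtain ⟨hgW, hgr⟩ := hg (jstar - 1) (by omega)
    exact subset_of_card_le_owaRank_add_one hWsttop (hu heq ▸ hfT _ hlast) hgW (by omega)
end

section
/- For the AV-rule with lexicographic tie-breaking, assume every voter has a full-rank set-extension. If A is a lazy-PNE with outcome W_A, then either W* ⊆ W_A or W_A ⊆ W*. -/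
open Finset

/-- Erasing `x` and inserting `w` does not change the rank of `c` when `x` and `w` compare
to `c` in the same way. -/
lemma owaRank_insert_erase {C : Type*} [DecidableEq C] {u : C → ℝ} {W : Finset C} {x w c : C}
    (hx : x ∈ W) (hw : w ∉ W) (h : u c < u x ↔ u c < u w) :
    owaRank u (insert w (W.erase x)) c = owaRank u W c := by
  unfold owaRank
  rw [filter_insert, filter_erase]
  by_cases hc : u c < u x
  · rw [if_pos (h.1 hc), card_insert_of_notMem (by simp [hw]),
      card_erase_add_one (by simp [hx, hc])]
  · rw [if_neg (fun h' => hc (h.2 h')), erase_eq_of_notMem (by simp [hc])]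

/-- Replacing a committee member by a preferred non-member weakly improves the OWA utility, and
strictly so if the position the new member takes has positive weight. -/
lemma owaUtil_insert_erase {C : Type*} [DecidableEq C] {u : C → ℝ}
    (hu : Function.Injective u) {lam : ℕ → ℝ} (hlam : ∀ n, 0 ≤ lam n) (W : Finset C) (x w : C)
    (hx : x ∈ W) (hw : w ∉ W) (hxw : u x < u w) :
    owaUtil lam u W ≤ owaUtil lam u (insert w (W.erase x)) ∧
      (0 < lam (owaRank u W w) →
        owaUtil lam u W < owaUtil lam u (insert w (W.erase x))) := by
  induction hn : (W.filter fun z => u x < u z ∧ u z < u w).card using Nat.strong_induction_on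
    generalizing W x w with
  | _ n ih =>
  by_cases hz : ∃ z ∈ W, u x < u z ∧ u z < u w
  · obtain ⟨z, hzW, hxz, hzw⟩ := hz
    have hxz' : x ≠ z := by rintro rfl; exact lt_irrefl _ hxz
    have hzw' : z ≠ w := by rintro rfl; exact lt_irrefl _ hzw
    have hxw' : x ≠ w := by rintro rfl; exact lt_irrefl _ hxw
    have h1 := ih _ (by
      rw [← hn]
      apply card_lt_card
      refine ⟨fun c hc => ?_, fun hc => ?_⟩
      · simp only [mem_filter] at hc ⊢
        exact ⟨hc.1, hxz.trans hc.2.1, hc.2.2⟩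
      · have := hc (mem_filter.2 ⟨hzW, hxz, hzw⟩)
        simp at this) W z w hzW hw hzw rfl
    have h2 := ih _ (by
      rw [← hn]
      apply card_lt_card
      refine ⟨fun c hc => ?_, fun hc => ?_⟩
      · simp only [mem_filter, mem_insert, mem_erase] at hc ⊢
        obtain ⟨rfl | hcW, hc1, hc2⟩ := hc
        · exact absurd hc2 hzw.not_gt
        · exact ⟨hcW.2, hc1, hc2.trans hzw⟩
      · have := hc (mem_filter.2 ⟨hzW, hxz, hzw⟩)
        simp at this) (insert w (W.erase z)) x z (by simp [hx, hxz']) (by simp [hzw']) hxz rfl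
    have e : insert z ((insert w (W.erase z)).erase x) = insert w (W.erase x) := by
      ext c
      simp only [mem_insert, mem_erase]
      grind
    rw [e] at h2
    exact ⟨h1.1.trans h2.1, fun h => (h1.2 h).trans_le h2.1⟩
  · push Not at hz
    have hrest : ∀ c ∈ W.erase x, owaRank u (insert w (W.erase x)) c = owaRank u W c := by
      intro c hc
      rw [mem_erase] at hc
      refine owaRank_insert_erase hx hw ⟨fun h => h.trans hxw, fun h => ?_⟩
      by_contra h'
      exact absurd h (hz c hc.2
        (lt_of_le_of_ne (not_lt.1 h') fun e => hc.1 (hu e).symm)).not_gt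
    have hrw : owaRank u (insert w (W.erase x)) w = owaRank u W w :=
      owaRank_insert_erase hx hw (by simp [hxw.le])
    have hrx : owaRank u W x = owaRank u W w := by
      unfold owaRank
      congr 1
      ext c
      simp only [mem_filter, and_congr_right_iff]
      refine fun hc => ⟨fun h => lt_of_le_of_ne (hz c hc h) fun e => hw (hu e ▸ hc),
        fun h => hxw.trans h⟩
    have hW : owaUtil lam u W = lam (owaRank u W w) * u x +
        ∑ c ∈ W.erase x, lam (owaRank u W c) * u c := by
      rw [← hrx, owaUtil, add_sum_erase _ (fun c => lam (owaRank u W c) * u c) hx]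
    have hW' : owaUtil lam u (insert w (W.erase x)) = lam (owaRank u W w) * u w +
        ∑ c ∈ W.erase x, lam (owaRank u W c) * u c := by
      rw [owaUtil, sum_insert (by simp [hw]), hrw]
      congr 1
      exact sum_congr rfl fun c hc => by rw [hrest c hc]
    rw [hW, hW']
    exact ⟨by have := mul_le_mul_of_nonneg_left hxw.le (hlam (owaRank u W w)); linarith,
      fun h => by have := mul_lt_mul_of_pos_left hxw h; linarith⟩

/-- Every committee containing the `j` most preferred candidates `T` has the same OWA utility as
`T`, when all weights after the `j`-th vanish. -/
lemma owaUtil_eq_of_top_subset {C : Type*} [DecidableEq C] {u : C → ℝ} {lam : ℕ → ℝ}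
    {T W : Finset C} (htop : ∀ c ∈ T, ∀ c' ∉ T, u c' < u c)
    (hz : ∀ n, T.card ≤ n → lam n = 0) (hTW : T ⊆ W) :
    owaUtil lam u W = owaUtil lam u T := by
  unfold owaUtil
  rw [← sum_subset hTW (fun c _ hcT => ?_)]
  · refine sum_congr rfl fun c hc => ?_
    have : owaRank u W c = owaRank u T c := by
      unfold owaRank
      congr 1
      ext d
      simp only [mem_filter]
      refine ⟨fun h => ⟨?_, h.2⟩, fun h => ⟨hTW h.1, h.2⟩⟩
      by_contra hd
      exact (htop c hc d hd).not_gt h.2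
    rw [this]
  · have : T.card ≤ owaRank u W c :=
      card_le_card fun d hd => mem_filter.2 ⟨hTW hd, htop d hd c hcT⟩
    rw [hz _ this, zero_mul]

/-- Any candidate among the top `T` would take a position smaller than `#T` in a committee. -/
lemma owaRank_lt_card_of_mem_top {C : Type*} {u : C → ℝ} {T W : Finset C} {w : C}
    (htop : ∀ c ∈ T, ∀ c' ∉ T, u c' < u c) (hw : w ∈ T) : owaRank u W w < T.card := by
  refine card_lt_card ⟨fun d hd => ?_, fun h => ?_⟩
  · by_contra hdT
    exact (htop w hw d hdT).not_gt (mem_filter.1 hd).2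
  · exact lt_irrefl _ (mem_filter.1 (h hw)).2

section Winners

variable {N C : Type*} [Fintype N] [LinearOrder C]

lemma beats_av_iff {A : N → Finset C} {c d : C} :
    beats (fun _ n => (n : ℝ)) A c d ↔
      score A d < score A c ∨ (score A c = score A d ∧ c < d) := by
  simp [beats]

lemma beats_of_ne (A : N → Finset C) {c d : C} (h : c ≠ d) :
    beats (fun _ n => (n : ℝ)) A c d ∨ beats (fun _ n => (n : ℝ)) A d c := by
  simp only [beats_av_iff]
  rcases lt_trichotomy (score A c) (score A d) with h1 | h1 | h1
  · exact .inr (.inl h1)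
  · rcases lt_or_gt_of_ne h with h2 | h2
    · exact .inl (.inr ⟨h1, h2⟩)
    · exact .inr (.inr ⟨h1.symm, h2⟩)
  · exact .inl (.inl h1)

lemma score_update_of_mem_iff [DecidableEq N] {A : N → Finset C} {i : N} {B : Finset C} {c : C}
    (h : c ∈ B ↔ c ∈ A i) : score (Function.update A i B) c = score A c := by
  unfold score
  congr 1
  ext j
  rcases eq_or_ne j i with rfl | hj <;> simp [*]

lemma score_update_erase_le [DecidableEq N] (A : N → Finset C) (i : N) (x c : C) :
    score (Function.update A i ((A i).erase x)) c ≤ score A c := by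
  refine card_le_card fun j hj => ?_
  rcases eq_or_ne j i with rfl | hne <;> simp_all

variable [Fintype C]

open Classical in
/-- The number of candidates ranked above `c`. -/
noncomputable def beatersCard (A : N → Finset C) (c : C) : ℕ :=
  (univ.filter fun c' => beats (fun _ n => (n : ℝ)) A c' c).card

lemma mem_winners_iff {k : ℕ} {A : N → Finset C} {c : C} :
    c ∈ winners (fun _ n => (n : ℝ)) k A ↔ beatersCard A c < k := by
  simp only [winners, beatersCard, mem_filter, mem_univ, true_and]

lemma beatersCard_lt_of_beats {A : N → Finset C} {c d : C}
    (h : beats (fun _ n => (n : ℝ)) A c d) : beatersCard A c < beatersCard A d := by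
  refine card_lt_card ⟨fun e he => ?_, fun h' => ?_⟩
  · simp only [mem_filter, mem_univ, true_and, beats_av_iff] at *
    rcases h with h | ⟨h, h'⟩ <;> rcases he with he | ⟨he, he'⟩
    · exact .inl (h.trans he)
    · exact .inl (by omega)
    · exact .inl (by omega)
    · exact .inr ⟨he.trans h, he'.trans h'⟩
  · have := h' (by simpa using h)
    simp [beats_av_iff] at this

lemma beatersCard_injective (A : N → Finset C) : Function.Injective (beatersCard A) := by
  intro c d h
  by_contra hne
  rcases beats_of_ne A hne with hb | hb
  · exact (beatersCard_lt_of_beats hb).ne h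
  · exact (beatersCard_lt_of_beats hb).ne h.symm

lemma card_winners {k : ℕ} (hk : k ≤ Fintype.card C) (A : N → Finset C) :
    (winners (fun _ n => (n : ℝ)) k A).card = k := by
  have himg : univ.image (beatersCard A) = range (Fintype.card C) := by
    refine eq_of_subset_of_card_le (fun n hn => ?_) ?_
    · obtain ⟨c, -, rfl⟩ := mem_image.1 hn
      refine mem_range.2 (card_lt_univ_of_notMem (x := c) ?_)
      simp [beats_av_iff]
    · rw [card_image_of_injective _ (beatersCard_injective A), card_univ, card_range]
  have : (winners (fun _ n => (n : ℝ)) k A).image (beatersCard A) = range k := by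
    ext n
    simp only [mem_image, mem_winners_iff, mem_range]
    refine ⟨by rintro ⟨c, hc, rfl⟩; exact hc, fun hn => ?_⟩
    obtain ⟨c, -, rfl⟩ := mem_image.1 (himg ▸ mem_range.2 (hn.trans_le hk))
    exact ⟨c, hn, rfl⟩
  rw [← card_image_of_injective _ (beatersCard_injective A), this, card_range]

/-- A committee of size `k` each of whose members is ranked above every non-member wins. -/
lemma winners_eq_of_beats {k : ℕ} {A : N → Finset C} {W : Finset C} (hk : W.card = k)
    (h : ∀ c ∈ W, ∀ d ∉ W, beats (fun _ n => (n : ℝ)) A c d) :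
    winners (fun _ n => (n : ℝ)) k A = W := by
  refine eq_of_subset_of_card_le (fun d hd => ?_) ?_
  · by_contra hdW
    refine (mem_winners_iff.1 hd).not_ge (hk ▸ card_le_card fun c hc => ?_)
    simpa using h c hc d hdW
  · exact hk ▸ (card_winners (hk ▸ card_le_univ W) A).ge

lemma beats_of_mem_winners {k : ℕ} {A : N → Finset C} {c d : C}
    (hc : c ∈ winners (fun _ n => (n : ℝ)) k A) (hd : d ∉ winners (fun _ n => (n : ℝ)) k A) :
    beats (fun _ n => (n : ℝ)) A c d := by
  rw [mem_winners_iff] at hc hd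
  rcases beats_of_ne A (c := c) (d := d) (by rintro rfl; exact hd hc) with h | h
  · exact h
  · exact absurd ((beatersCard_lt_of_beats h).trans hc) hd

variable [DecidableEq N]

/-- Withdrawing the approval of `x` does not hurt any other winner. -/
lemma mem_winners_update_erase {k : ℕ} {A : N → Finset C} {i : N} {x c : C} (hcx : c ≠ x)
    (hc : c ∈ winners (fun _ n => (n : ℝ)) k A) :
    c ∈ winners (fun _ n => (n : ℝ)) k (Function.update A i ((A i).erase x)) := by
  rw [mem_winners_iff] at hc ⊢
  refine (card_le_card fun d hd => ?_).trans_lt hc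
  simp only [mem_filter, mem_univ, true_and, beats_av_iff] at hd ⊢
  rw [score_update_of_mem_iff (c := c) (by simp [hcx])] at hd
  have := score_update_erase_le A i x d
  rcases hd with h | ⟨h, h'⟩
  · exact .inl (by omega)
  · rcases this.eq_or_lt with e | e
    · exact .inr ⟨by omega, h'⟩
    · exact .inl (by omega)

lemma winners_update_erase_of_notMem {k : ℕ} (hk : k ≤ Fintype.card C) {A : N → Finset C}
    {i : N} {x : C} (hx : x ∉ winners (fun _ n => (n : ℝ)) k A) :
    winners (fun _ n => (n : ℝ)) k (Function.update A i ((A i).erase x)) =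
      winners (fun _ n => (n : ℝ)) k A :=
  (eq_of_subset_of_card_le
    (fun _ hc => mem_winners_update_erase (ne_of_mem_of_not_mem hc hx) hc)
    (by rw [card_winners hk, card_winners hk])).symm

variable {k : ℕ} {A : N → Finset C} {i : N} {lam : ℕ → ℝ} {u : C → ℝ}

/-- In a minimal best response, withdrawing an approval strictly lowers the utility. -/
lemma MinimalBestResponse.owaUtil_erase_ne
    (h : MinimalBestResponse (fun _ n => (n : ℝ)) k lam u A i (A i)) {x : C} (hx : x ∈ A i) :
    owaUtil lam u (winners (fun _ n => (n : ℝ)) k (Function.update A i ((A i).erase x))) ≠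
      owaUtil lam u (winners (fun _ n => (n : ℝ)) k A) := by
  intro e
  have hbr : BestResponse (fun _ n => (n : ℝ)) k lam u A i ((A i).erase x) := by
    intro B'
    have := h.1 B'
    rwa [Function.update_eq_self, ← e] at this
  exact (h.2 _ hbr).not_gt (card_erase_lt_of_mem hx)

/-- Minimal best responses approve winners only. -/
lemma MinimalBestResponse.subset_winners (hk : k ≤ Fintype.card C)
    (h : MinimalBestResponse (fun _ n => (n : ℝ)) k lam u A i (A i)) :
    A i ⊆ winners (fun _ n => (n : ℝ)) k A := by
  intro x hx
  by_contra hxW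
  exact h.owaUtil_erase_ne hx (by rw [winners_update_erase_of_notMem hk hxW])

/-- If all losers have no approvals and nobody but `i` approves the winner `x`, then `i` can
replace `x` by any loser `w`. -/
lemma winners_update_insert_erase (hk : k ≤ Fintype.card C)
    (hA : ∀ j, A j ⊆ winners (fun _ n => (n : ℝ)) k A) {x w : C}
    (hx : x ∈ winners (fun _ n => (n : ℝ)) k A) (hxA : ∀ j, j ≠ i → x ∉ A j)
    (hw : w ∉ winners (fun _ n => (n : ℝ)) k A) :
    winners (fun _ n => (n : ℝ)) k
        (Function.update A i (insert w ((winners (fun _ n => (n : ℝ)) k A).erase x))) =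
      insert w ((winners (fun _ n => (n : ℝ)) k A).erase x) := by
  set W := winners (fun _ n => (n : ℝ)) k A with hW
  refine winners_eq_of_beats ?_ fun c hc d hd => ?_
  · rw [card_insert_of_notMem (by simp [hw]), card_erase_add_one hx, hW, card_winners hk]
  · refine beats_av_iff.2 (.inl ?_)
    have hd0 : score (Function.update A i (insert w (W.erase x))) d = 0 := by
      refine card_eq_zero.2 (filter_eq_empty_iff.2 fun j _ hj => ?_)
      rcases eq_or_ne j i with rfl | hne
      · exact hd (by simpa using hj)
      · rw [Function.update_of_ne hne] at hj
        refine hd (mem_insert_of_mem (mem_erase.2 ⟨?_, hA j hj⟩))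
        rintro rfl
        exact hxA j hne hj
    rw [hd0]
    exact card_pos.2 ⟨i, by simpa using hc⟩

/-- If all losers have no approvals and some winner outside a full-rank voter's top candidates `T`
is approved by nobody else, then the voter's best response makes all of `T` win. -/
lemma BestResponse.top_subset_winners (hk : k ≤ Fintype.card C)
    (h : BestResponse (fun _ n => (n : ℝ)) k lam u A i (A i))
    (hA : ∀ j, A j ⊆ winners (fun _ n => (n : ℝ)) k A)
    (hu : Function.Injective u) (hlam : ∀ n, 0 ≤ lam n) {T : Finset C}
    (htop : ∀ c ∈ T, ∀ c' ∉ T, u c' < u c) (hfull : ∀ n, n < T.card → 0 < lam n)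
    {x : C} (hx : x ∈ winners (fun _ n => (n : ℝ)) k A) (hxT : x ∉ T)
    (hxA : ∀ j, j ≠ i → x ∉ A j) :
    T ⊆ winners (fun _ n => (n : ℝ)) k A := by
  intro w hwT
  by_contra hw
  have hle := h (insert w ((winners (fun _ n => (n : ℝ)) k A).erase x))
  rw [winners_update_insert_erase hk hA hx hxA hw, Function.update_eq_self] at hle
  exact hle.not_gt ((owaUtil_insert_erase hu hlam _ x w hx hw (htop w hwT x hxT)).2
    (hfull _ (owaRank_lt_card_of_mem_top htop hwT)))

/-- If all losers have no approvals, a full-rank voter's minimal best response approves only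
candidates among its top candidates `T`. -/
lemma MinimalBestResponse.subset_top (hk : k ≤ Fintype.card C)
    (h : MinimalBestResponse (fun _ n => (n : ℝ)) k lam u A i (A i))
    (hA : ∀ j, A j ⊆ winners (fun _ n => (n : ℝ)) k A)
    (hu : Function.Injective u) (hlam : ∀ n, 0 ≤ lam n) {T : Finset C}
    (htop : ∀ c ∈ T, ∀ c' ∉ T, u c' < u c) (hfull : ∀ n, n < T.card → 0 < lam n)
    (hz : ∀ n, T.card ≤ n → lam n = 0) : A i ⊆ T := by
  intro x hx
  by_contra hxT
  have hxW := hA i hx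
  refine h.owaUtil_erase_ne hx ?_
  by_cases hxA : ∀ j, j ≠ i → x ∉ A j
  · have hTW := h.1.top_subset_winners hk hA hu hlam htop hfull hxW hxT hxA
    rw [owaUtil_eq_of_top_subset htop hz hTW, owaUtil_eq_of_top_subset htop hz fun c hc =>
      mem_winners_update_erase (ne_of_mem_of_not_mem hc hxT) (hTW hc)]
  · push Not at hxA
    obtain ⟨j, hj, hxj⟩ := hxA
    congr 1
    refine winners_eq_of_beats (card_winners hk A) fun c hc d hd => ?_
    have hdx : d ≠ x := (ne_of_mem_of_not_mem hxW hd).symm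
    rcases eq_or_ne c x with rfl | hcx
    · refine beats_av_iff.2 (.inl ?_)
      have hd0 : score (Function.update A i ((A i).erase c)) d = 0 := by
        rw [score_update_of_mem_iff (by simp [hdx])]
        exact card_eq_zero.2 (filter_eq_empty_iff.2 fun l _ hl => hd (hA l hl))
      rw [hd0]
      exact card_pos.2 ⟨j, by simpa [hj] using hxj⟩
    · have := beats_of_mem_winners hc hd
      rw [beats_av_iff] at this ⊢
      rwa [score_update_of_mem_iff (by simp [hdx]), score_update_of_mem_iff (by simp [hcx])]

end Winners

/-- under the full-rank assumption, the outcome of any lazy-PNE of the AV-rule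
satisfies `W* ⊆ W_A` or `W_A ⊆ W*`. -/
theorem statement_11 {N C : Type*} [Fintype N] [DecidableEq N] [Fintype C] [LinearOrder C]
    (k : ℕ) (hk1 : 1 ≤ k) (hk2 : k ≤ Fintype.card C)
    (u : N → C → ℝ) (hu : ∀ i, Function.Injective (u i))
    (lam : N → ℕ → ℝ) (hlam : ∀ i n, 0 ≤ lam i n)
    (jstar : N → ℕ) (hj1 : ∀ i, 1 ≤ jstar i) (hjk : ∀ i, jstar i ≤ k)
    (hz : ∀ i n, jstar i ≤ n → lam i n = 0)
    (hfull : ∀ i n, n < jstar i → 0 < lam i n)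
    (Wst : N → Finset C) (hWstcard : ∀ i, (Wst i).card = jstar i)
    (hWsttop : ∀ i, ∀ c ∈ Wst i, ∀ c' ∉ Wst i, u i c' < u i c)
    (A : N → Finset C)
    (hPNE : LazyPNE (fun _ n => (n : ℝ)) k lam u A) :
    Finset.univ.biUnion Wst ⊆ winners (fun _ n => (n : ℝ)) k A ∨
      winners (fun _ n => (n : ℝ)) k A ⊆ Finset.univ.biUnion Wst := by
  have hA : ∀ j, A j ⊆ winners (fun _ n => (n : ℝ)) k A := fun j => (hPNE j).subset_winners hk2
  refine or_iff_not_imp_right.2 fun hnot => biUnion_subset.2 fun i _ => ?_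
  obtain ⟨x, hxW, hx⟩ := not_subset.1 hnot
  have hxT : ∀ j, x ∉ Wst j := fun j hj => hx (mem_biUnion.2 ⟨j, mem_univ j, hj⟩)
  refine (hPNE i).1.top_subset_winners hk2 hA (hu i) (hlam i) (hWsttop i)
    (fun n hn => hfull i n (hWstcard i ▸ hn)) hxW (hxT i) fun j _ hxj => hxT j ?_
  exact (hPNE j).subset_top hk2 hA (hu j) (hlam j) (hWsttop j)
    (fun n hn => hfull j n (hWstcard j ▸ hn)) (fun n hn => hz j n (hWstcard j ▸ hn)) hxj
end
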